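/- Let e and f be properly infinite, equidimensional projections in an AW*-algebra A. If c(e) = c(f) and e ≺ f, then d(e) < d(f). -/

import Mathlib

universe u

section Defs

variable {R : Type u} [Ring R] [StarRing R]

/-- An element is a projection if it is self-adjoint and idempotent. -/
def IsProjection (p : R) : Prop := star p = p ∧ p * p = p

/-- Order on projections: `e ≤ f` iff `e = ef`. -/
def ProjLE (e f : R) : Prop := e * f = e

/-- Murray–von Neumann equivalence of projections. -/
def ProjEquiv (e f : R) : Prop := ∃ v : R, star v * v = e ∧ v * star v = f

/-- `e ≼ f` : `e` is equivalent to a subprojection of `f`. -/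
def ProjSubEquiv (e f : R) : Prop :=
  ∃ e' : R, IsProjection e' ∧ ProjLE e' f ∧ ProjEquiv e e'

/-- `e ≺ f` : `e ≼ f` but `e` is not equivalent to `f` (with the convention `0 ≺ 0`). -/
def ProjLT (e f : R) : Prop :=
  (ProjSubEquiv e f ∧ ¬ ProjEquiv e f) ∨ (e = 0 ∧ f = 0)

/-- A central projection. -/
def IsCentralProj (z : R) : Prop := IsProjection z ∧ ∀ a : R, z * a = a * z

/-- `c` is the central cover of `e`: the least central projection above `e`. -/
def IsCentralCover (e c : R) : Prop :=
  IsCentralProj c ∧ ProjLE e c ∧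
    ∀ z : R, IsCentralProj z → ProjLE e z → ProjLE c z

/-- A projection `e` is finite if `e ∼ f ≤ e` implies `f = e`. -/
def ProjFinite (e : R) : Prop :=
  ∀ f : R, IsProjection f → ProjEquiv e f → ProjLE f e → f = e

/-- A nonzero projection is properly infinite if `ze` is infinite
for every central projection `z` with `ze ≠ 0`. -/
def ProperlyInfinite (e : R) : Prop :=
  IsProjection e ∧ e ≠ 0 ∧
    ∀ z : R, IsCentralProj z → z * e ≠ 0 → ¬ ProjFinite (z * e)

/-- A pairwise orthogonal family of elements. -/
def PairwiseOrthogonal {ι : Type*} (p : ι → R) : Prop :=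
  ∀ i j, i ≠ j → p i * p j = 0

/-- `s` is the supremum of the family `p` in the projection order. For an
orthogonal family, this is the sum `Σ pᵢ`. -/
def IsSupProj {ι : Type*} (p : ι → R) (s : R) : Prop :=
  IsProjection s ∧ (∀ i, ProjLE (p i) s) ∧
    ∀ t : R, IsProjection t → (∀ i, ProjLE (p i) t) → ProjLE s t

/-- The family `p` belongs to `Γ(e)`: an orthogonal family of projections,
each equivalent to `e`, with sum (supremum) `e`. -/
def InGamma (e : R) {ι : Type u} (p : ι → R) : Prop :=
  (∀ i, IsProjection (p i)) ∧ PairwiseOrthogonal p ∧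
    (∀ i, ProjEquiv (p i) e) ∧ IsSupProj p e

open Classical in
/-- The dimension `d(e)` of a properly infinite projection: the least cardinal
strictly greater than the cardinality of the index set of every family in
`Γ(e)`, with the convention `d(0) = 0`. -/
noncomputable def projDim (e : R) : Cardinal.{u} :=
  if e = 0 then 0
  else sSup {c : Cardinal.{u} |
    ∃ (ι : Type u) (p : ι → R), InGamma e p ∧ c = Order.succ (Cardinal.mk ι)}

/-- A properly infinite projection `e` is equidimensional if `d(ze) = d(e)`
for every central projection `z` with `ze ≠ 0` (equivalently, for every
nonzero central projection `z ≤ c(e)`). -/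
def Equidimensional (e : R) : Prop :=
  ProperlyInfinite e ∧
    ∀ z : R, IsCentralProj z → z * e ≠ 0 → projDim (z * e) = projDim e

/-- An abelian projection: the corner `eRe` is commutative. -/
def IsAbelianProj (e : R) : Prop :=
  IsProjection e ∧ ∀ a b : R, (e * a * e) * (e * b * e) = (e * b * e) * (e * a * e)

/-- `j` is the join `e ∨ f` in the projection lattice. -/
def IsJoinProj (e f j : R) : Prop :=
  IsProjection j ∧ ProjLE e j ∧ ProjLE f j ∧
    ∀ t : R, IsProjection t → ProjLE e t → ProjLE f t → ProjLE j t

end Defs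

/-- The AW*-condition: the right annihilator of any subset is generated by a
projection: `{a | ∀ s ∈ S, s a = 0} = pR`. -/
def IsAWStarRing (R : Type*) [Ring R] [StarRing R] : Prop :=
  ∀ S : Set R, ∃ p : R, IsProjection p ∧
    {a : R | ∀ s ∈ S, s * a = 0} = {a : R | ∃ b : R, a = p * b}

/-- A maximal abelian (*-sub)algebra. -/
def IsMaximalAbelian {A : Type*} [Ring A] [StarRing A] [Algebra ℂ A] [StarModule ℂ A]
    (M : StarSubalgebra ℂ A) : Prop :=
  (∀ x ∈ M, ∀ y ∈ M, x * y = y * x) ∧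
    ∀ N : StarSubalgebra ℂ A, (∀ x ∈ N, ∀ y ∈ N, x * y = y * x) → M ≤ N → M = N


set_option linter.unusedSectionVars false
set_option linter.unusedVariables false

namespace AWS

section
variable {A : Type u} [NormedRing A] [StarRing A] [CStarRing A]

lemma le_symm {e f : A} (he : IsProjection e) (hf : IsProjection f) (h : ProjLE e f) :
    f * e = e := by
  have := congrArg star h
  rwa [star_mul, he.1, hf.1] at this

lemma le_of_left {e f : A} (he : IsProjection e) (hf : IsProjection f) (h : f * e = e) :
    ProjLE e f := by
  have := congrArg star h
  rwa [star_mul, he.1, hf.1] at this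

lemma orth_symm {e f : A} (he : IsProjection e) (hf : IsProjection f) (h : e * f = 0) :
    f * e = 0 := by
  have := congrArg star h
  rwa [star_mul, he.1, hf.1, star_zero] at this

lemma le_refl' {e : A} (he : IsProjection e) : ProjLE e e := he.2

lemma le_trans' {e f g : A} (h : ProjLE e f) (h' : ProjLE f g) : ProjLE e g := by
  unfold ProjLE at *
  rw [← h, mul_assoc, h']

lemma le_antisymm' {e f : A} (he : IsProjection e) (hf : IsProjection f)
    (h : ProjLE e f) (h' : ProjLE f e) : e = f := by
  rw [← le_symm hf he h']
  exact h.symm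

lemma proj_zero : IsProjection (0 : A) := ⟨star_zero _, mul_zero _⟩
lemma proj_one : IsProjection (1 : A) := ⟨star_one _, mul_one _⟩

lemma proj_sub {e f : A} (he : IsProjection e) (hf : IsProjection f) (h : ProjLE e f) :
    IsProjection (f - e) := by
  refine ⟨by rw [star_sub, he.1, hf.1], ?_⟩
  have h2 := le_symm he hf h
  unfold ProjLE at h
  rw [sub_mul, mul_sub, mul_sub, h, h2, he.2, hf.2]; abel

lemma proj_compl {e : A} (he : IsProjection e) : IsProjection (1 - e) :=
  proj_sub he proj_one (mul_one _)

lemma sub_le' {e f : A} (hf : IsProjection f) (h : ProjLE e f) :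
    ProjLE (f - e) f := by
  unfold ProjLE at *
  rw [sub_mul, h, hf.2]

lemma proj_add {e f : A} (he : IsProjection e) (hf : IsProjection f) (h : e * f = 0) :
    IsProjection (e + f) := by
  refine ⟨by rw [star_add, he.1, hf.1], ?_⟩
  rw [add_mul, mul_add, mul_add, h, orth_symm he hf h, he.2, hf.2]; abel

lemma add_le' {e f g : A} (h : ProjLE e g) (h' : ProjLE f g) : ProjLE (e + f) g := by
  unfold ProjLE at *
  rw [add_mul, h, h']

lemma orth_of_le {e f g : A} (he : IsProjection e) (hf : IsProjection f)
    (h : ProjLE e f) (hg : f * g = 0) : e * g = 0 := by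
  rw [← h, mul_assoc, hg, mul_zero]

lemma orth_of_le2 {e f e' f' : A} (he : IsProjection e) (hf : IsProjection f)
    (he' : IsProjection e') (hf' : IsProjection f')
    (h : ProjLE e f) (h' : ProjLE e' f') (hg : f * f' = 0) : e * e' = 0 := by
  rw [← h, ← le_symm he' hf' h', mul_assoc, ← mul_assoc f, hg, zero_mul, mul_zero]

lemma pi_right {v e : A} (he : IsProjection e) (h : star v * v = e) : v * e = v := by
  have h0 : star (v * e - v) * (v * e - v) = 0 := by
    rw [star_sub, star_mul, he.1]
    have : (e * star v - star v) * (v * e - v)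
      = e * (star v * v) * e - e * (star v * v) - (star v * v) * e + star v * v := by
      noncomm_ring
    rw [this, h, he.2, he.2]; abel
  exact sub_eq_zero.1 ((CStarRing.star_mul_self_eq_zero_iff _).1 h0)

/-- all the data of an equivalence -/
lemma equiv_elim {e f : A} (he : IsProjection e) (h : ProjEquiv e f) :
    IsProjection f ∧ ∃ v : A, star v * v = e ∧ v * star v = f ∧ v * e = v ∧ f * v = v ∧
      e * star v = star v ∧ star v * f = star v := by
  obtain ⟨v, h1, h2⟩ := h
  have h3 := pi_right he h1
  have h5 : e * star v = star v := by
    have := congrArg star h3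
    rwa [star_mul, he.1] at this
  have h4 : f * v = v := by rw [← h2, mul_assoc, h1, h3]
  have hf : IsProjection f := by
    refine ⟨by rw [← h2, star_mul, star_star], ?_⟩
    nth_rewrite 2 [← h2]
    rw [← mul_assoc, h4, h2]
  refine ⟨hf, v, h1, h2, h3, h4, h5, ?_⟩
  rw [← h2, ← mul_assoc, h1, h5]

lemma equiv_refl {e : A} (he : IsProjection e) : ProjEquiv e e :=
  ⟨e, by rw [he.1, he.2], by rw [he.1, he.2]⟩

lemma equiv_symm {e f : A} (h : ProjEquiv e f) : ProjEquiv f e := by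
  obtain ⟨v, h1, h2⟩ := h
  exact ⟨star v, by rw [star_star, h2], by rw [star_star, h1]⟩

lemma equiv_trans {e f g : A} (he : IsProjection e) (h : ProjEquiv e f) (h' : ProjEquiv f g) :
    ProjEquiv e g := by
  obtain ⟨hf, v, h1, h2, h3, h4, h5, h6⟩ := equiv_elim he h
  obtain ⟨hg, w, k1, k2, k3, k4, k5, k6⟩ := equiv_elim hf h'
  refine ⟨w * v, ?_, ?_⟩
  · rw [star_mul, mul_assoc, ← mul_assoc (star w), k1, h4, h1]
  · rw [star_mul, mul_assoc, ← mul_assoc v, h2, ← mul_assoc, k3, k2]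

lemma equiv_zero {e : A} (h : ProjEquiv e 0) : e = 0 := by
  obtain ⟨v, h1, h2⟩ := h
  have : v = 0 := (CStarRing.mul_star_self_eq_zero_iff _).1 h2
  rw [← h1, this, mul_zero]

lemma equiv_zero' {e : A} (h : ProjEquiv 0 e) : e = 0 := equiv_zero (equiv_symm h)

lemma equiv_add {e e' f f' : A} (he : IsProjection e) (he' : IsProjection e')
    (h : ProjEquiv e f) (h' : ProjEquiv e' f') (ho : e * e' = 0) (hp : f * f' = 0) :
    ProjEquiv (e + e') (f + f') := by
  obtain ⟨hf, v, h1, h2, h3, h4, h5, h6⟩ := equiv_elim he h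
  obtain ⟨hf', w, k1, k2, k3, k4, k5, k6⟩ := equiv_elim he' h'
  have a1 : star v * w = 0 := by
    rw [← h6, ← k4, mul_assoc, ← mul_assoc f, hp, zero_mul, mul_zero]
  have a2 : star w * v = 0 := by
    have := congrArg star a1
    simpa using this
  have b1 : v * star w = 0 := by
    rw [← h3, ← k5, mul_assoc, ← mul_assoc e, ho, zero_mul, mul_zero]
  have b2 : w * star v = 0 := by
    have := congrArg star b1
    simpa using this
  refine ⟨v + w, ?_, ?_⟩
  · rw [star_add, add_mul, mul_add, mul_add, h1, k1, a1, a2]; abel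
  · rw [star_add, add_mul, mul_add, mul_add, h2, k2, b1, b2]; abel

/-- conjugation by a partial isometry -/
lemma conj_proj {v e f p : A} (h1 : star v * v = e) (hp : IsProjection p) (hle : ProjLE p e) :
    IsProjection (v * p * star v) := by
  refine ⟨by simp [mul_assoc, hp.1], ?_⟩
  have : v * p * star v * (v * p * star v) = v * (p * (star v * v) * p) * star v := by
    simp only [mul_assoc]
  rw [this, h1, show p * e = p from hle, hp.2]

lemma conj_equiv {v e p : A} (h1 : star v * v = e) (hp : IsProjection p) (hle : ProjLE p e) :
    ProjEquiv p (v * p * star v) := by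
  refine ⟨v * p, ?_, ?_⟩
  · have : star (v * p) * (v * p) = p * (star v * v) * p := by
      rw [star_mul, hp.1]; simp only [mul_assoc]
    rw [this, h1, show p * e = p from hle, hp.2]
  · rw [star_mul, hp.1, mul_assoc, ← mul_assoc p, hp.2, mul_assoc]

lemma conj_le {v f p : A} (h : star v * f = star v) :
    ProjLE (v * p * star v) f := by
  unfold ProjLE
  rw [mul_assoc, h]

lemma conj_mono {v e p q : A} (h1 : star v * v = e) (hle : ProjLE p e)
    (h : ProjLE p q) : ProjLE (v * p * star v) (v * q * star v) := by
  unfold ProjLE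
  have : v * p * star v * (v * q * star v) = v * (p * (star v * v) * q) * star v := by
    simp only [mul_assoc]
  rw [this, h1, show p * e = p from hle, show p * q = p from h]

lemma conj_orth {v e p q : A} (h1 : star v * v = e) (hle : ProjLE p e)
    (h : p * q = 0) : (v * p * star v) * (v * q * star v) = 0 := by
  have : v * p * star v * (v * q * star v) = v * (p * (star v * v) * q) * star v := by
    simp only [mul_assoc]
  rw [this, h1, show p * e = p from hle, h, mul_zero, zero_mul]

lemma sub_of_le {e f : A} (he : IsProjection e) (h : ProjLE e f) : ProjSubEquiv e f :=
  ⟨e, he, h, equiv_refl he⟩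

lemma sub_of_equiv {e f : A} (he : IsProjection e) (h : ProjEquiv e f) : ProjSubEquiv e f :=
  ⟨f, (equiv_elim he h).1, (equiv_elim he h).1.2, h⟩

lemma sub_trans {e f g : A} (he : IsProjection e) (hf : IsProjection f)
    (h : ProjSubEquiv e f) (h' : ProjSubEquiv f g) :
    ProjSubEquiv e g := by
  obtain ⟨x, hx, hxf, hex⟩ := h
  obtain ⟨y, hy, hyg, hfy⟩ := h'
  obtain ⟨-, w, k1, k2, k3, k4, k5, k6⟩ := equiv_elim hf hfy
  exact ⟨w * x * star w, conj_proj (f := y) k1 hx hxf, le_trans' (conj_le k6) hyg,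
    equiv_trans he hex (conj_equiv k1 hx hxf)⟩

/-- central projections -/
lemma central_mul {z p : A} (hz : IsCentralProj z) (hp : IsProjection p) :
    IsProjection (z * p) := by
  refine ⟨by rw [star_mul, hp.1, hz.1.1, hz.2], ?_⟩
  rw [mul_assoc, ← mul_assoc p, ← hz.2 p, mul_assoc z, hp.2, ← mul_assoc, hz.1.2]

lemma central_mul_central {z w : A} (hz : IsCentralProj z) (hw : IsCentralProj w) :
    IsCentralProj (z * w) :=
  ⟨central_mul hz hw.1, fun a => by rw [mul_assoc, hw.2, ← mul_assoc, hz.2, mul_assoc]⟩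

lemma central_compl {z : A} (hz : IsCentralProj z) : IsCentralProj (1 - z) :=
  ⟨proj_compl hz.1, fun a => by rw [sub_mul, mul_sub, hz.2, one_mul, mul_one]⟩

lemma central_le {z p : A} (hz : IsCentralProj z) (hp : IsProjection p) : ProjLE (z * p) p := by
  unfold ProjLE; rw [mul_assoc, hp.2]

lemma central_le_left {z p : A} (hz : IsCentralProj z) : ProjLE (z * p) z := by
  unfold ProjLE; rw [← hz.2, ← mul_assoc, hz.1.2]

lemma central_mono {z p q : A} (hz : IsCentralProj z) (h : ProjLE p q) :
    ProjLE (z * p) (z * q) := by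
  unfold ProjLE
  rw [mul_assoc, ← mul_assoc p, ← hz.2 p, mul_assoc z p q, show p * q = p from h,
    ← mul_assoc, hz.1.2]

lemma central_orth {z p q : A} (hz : IsCentralProj z) (h : p * q = 0) :
    (z * p) * (z * q) = 0 := by
  rw [mul_assoc, ← mul_assoc p, ← hz.2 p, mul_assoc z p q, h, mul_zero, mul_zero]

lemma central_equiv {z e f : A} (hz : IsCentralProj z) (h : ProjEquiv e f) :
    ProjEquiv (z * e) (z * f) := by
  obtain ⟨v, h1, h2⟩ := h
  refine ⟨z * v, ?_, ?_⟩
  · rw [star_mul, hz.1.1, mul_assoc, ← mul_assoc z z, hz.1.2, hz.2, ← mul_assoc, h1, hz.2]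
  · rw [star_mul, hz.1.1, mul_assoc, ← mul_assoc v, h2, ← hz.2, ← mul_assoc, hz.1.2]

lemma central_sub {z e f : A} (hz : IsCentralProj z) (h : ProjSubEquiv e f) :
    ProjSubEquiv (z * e) (z * f) := by
  obtain ⟨x, hx, hxf, hex⟩ := h
  exact ⟨z * x, central_mul hz hx, central_mono hz hxf, central_equiv hz hex⟩

/-- suprema -/
lemma exists_sup (hAW : IsAWStarRing A) {ι : Type*} (p : ι → A) (hp : ∀ i, IsProjection (p i)) :
    ∃ s, IsSupProj p s := by
  obtain ⟨q, hq, h⟩ := hAW (Set.range p)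
  have h0 : ∀ i, p i * q = 0 := by
    have : q ∈ {a : A | ∀ s ∈ Set.range p, s * a = 0} := by
      rw [h]; exact ⟨1, (mul_one _).symm⟩
    exact fun i => this _ ⟨i, rfl⟩
  refine ⟨1 - q, proj_compl hq, fun i => ?_, fun t ht hpt => ?_⟩
  · unfold ProjLE; rw [mul_sub, h0, mul_one, sub_zero]
  · have : (1 - t) ∈ {a : A | ∀ s ∈ Set.range p, s * a = 0} := by
      rintro _ ⟨i, rfl⟩
      rw [mul_sub, show p i * t = p i from hpt i, mul_one, sub_self]
    rw [h] at this
    obtain ⟨b, hb⟩ := this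
    have h2 : (1 - q) * (1 - t) = 0 := by
      rw [hb, ← mul_assoc, sub_mul, hq.2, one_mul, sub_self, zero_mul]
    rw [mul_sub, mul_one, sub_eq_zero] at h2
    exact h2.symm

lemma sup_ann (hAW : IsAWStarRing A) {ι : Type*} {p : ι → A} {s : A}
    (hp : ∀ i, IsProjection (p i)) (hs : IsSupProj p s)
    {x : A} (hx : ∀ i, x * p i = 0) : x * s = 0 := by
  obtain ⟨q, hq, h⟩ := hAW {x}
  have h0 : x * q = 0 := by
    have : q ∈ {a : A | ∀ s ∈ ({x} : Set A), s * a = 0} := by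
      rw [h]; exact ⟨1, (mul_one _).symm⟩
    exact this _ rfl
  have h1 : ∀ i, ProjLE (p i) q := fun i => by
    have : p i ∈ {a : A | ∀ s ∈ ({x} : Set A), s * a = 0} := by
      rintro _ rfl; exact hx i
    rw [h] at this
    obtain ⟨b, hb⟩ := this
    apply le_of_left (hp i) hq
    rw [hb, ← mul_assoc, hq.2]
  have h2 := le_symm hs.1 hq (hs.2.2 q hq h1)
  rw [← h2, ← mul_assoc, h0, zero_mul]

lemma sup_of_ann {ι : Type*} {p : ι → A} {s : A} (hs : IsProjection s) (hle : ∀ i, ProjLE (p i) s)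
    (h : ∀ x : A, (∀ i, x * p i = 0) → x * s = 0) (hp : ∀ i, IsProjection (p i)) :
    IsSupProj p s := by
  refine ⟨hs, hle, fun t ht hpt => ?_⟩
  have := h (1 - t) (fun i => by
    rw [sub_mul, le_symm (hp i) ht (hpt i), one_mul, sub_self])
  rw [sub_mul, one_mul, sub_eq_zero] at this
  exact le_of_left hs ht this.symm

/-- Schroeder-Bernstein -/
lemma schroeder_bernstein (hAW : IsAWStarRing A) {e f : A} (he : IsProjection e)
    (hf : IsProjection f) (h : ProjSubEquiv e f) (h' : ProjSubEquiv f e) : ProjEquiv e f := by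
  obtain ⟨f', hf', hf'f, hef'⟩ := h
  obtain ⟨e', he', he'e, hfe'⟩ := h'
  obtain ⟨-, v, h1, h2, h3, h4, h5, h6⟩ := equiv_elim he hef'
  obtain ⟨-, w, k1, k2, k3, k4, k5, k6⟩ := equiv_elim hf hfe'
  have hg : ∀ x, IsProjection x → ProjLE x e →
      IsProjection (v * x * star v) ∧ ProjLE (v * x * star v) f ∧
      IsProjection (f - v * x * star v) ∧ ProjLE (f - v * x * star v) f := by
    intro x hx hxe
    have a1 := conj_proj (f := f') h1 hx hxe
    have a2 : ProjLE (v * x * star v) f := le_trans' (conj_le h6) hf'f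
    exact ⟨a1, a2, proj_sub a1 hf a2, sub_le' hf a2⟩
  set φ : A → A := fun x => e - w * (f - v * x * star v) * star w with hφ
  have hφp : ∀ x, IsProjection x → ProjLE x e → IsProjection (φ x) ∧ ProjLE (φ x) e := by
    intro x hx hxe
    obtain ⟨a1, a2, a3, a4⟩ := hg x hx hxe
    have b1 := conj_proj (f := e') k1 a3 a4
    have b2 : ProjLE (w * (f - v * x * star v) * star w) e := le_trans' (conj_le k6) he'e
    exact ⟨proj_sub b1 he b2, sub_le' he b2⟩
  have hmono : ∀ x y, IsProjection x → ProjLE x e → IsProjection y → ProjLE y e → ProjLE x y →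
      ProjLE (φ x) (φ y) := by
    intro x y hx hxe hy hye hxy
    obtain ⟨a1, a2, a3, a4⟩ := hg x hx hxe
    obtain ⟨b1, b2, b3, b4⟩ := hg y hy hye
    have c1 := conj_mono h1 hxe hxy
    have c2 : ProjLE (f - v * y * star v) (f - v * x * star v) := by
      unfold ProjLE at *
      rw [sub_mul, mul_sub, mul_sub, hf.2, b2, le_symm a1 hf a2, le_symm a1 b1 c1]; abel
    have c3 := conj_mono k1 b4 c2
    have d1 := conj_proj (f := e') k1 a3 a4
    have d2 : ProjLE (w * (f - v * x * star v) * star w) e := le_trans' (conj_le k6) he'e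
    have e1 := conj_proj (f := e') k1 b3 b4
    have e2 : ProjLE (w * (f - v * y * star v) * star w) e := le_trans' (conj_le k6) he'e
    simp only [hφ]
    generalize w * (f - v * x * star v) * star w = X at *
    generalize w * (f - v * y * star v) * star w = Y at *
    unfold ProjLE at *
    rw [sub_mul, mul_sub, mul_sub, he.2, d2, le_symm e1 he e2, le_symm e1 d1 c3]; abel
  let S := {x : A // IsProjection x ∧ ProjLE x e ∧ ProjLE x (φ x)}
  obtain ⟨p, hp⟩ := exists_sup hAW (fun x : S => x.1) (fun x => x.2.1)
  have hpe : ProjLE p e := hp.2.2 e he (fun x => x.2.2.1)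
  have hp1 : ProjLE p (φ p) := hp.2.2 _ (hφp p hp.1 hpe).1 (fun x =>
    le_trans' x.2.2.2 (hmono _ _ x.2.1 x.2.2.1 hp.1 hpe (hp.2.1 x)))
  have hp2 : ProjLE (φ p) p := by
    obtain ⟨a1, a2⟩ := hφp p hp.1 hpe
    exact hp.2.1 ⟨φ p, a1, a2, hmono _ _ hp.1 hpe a1 a2 hp1⟩
  have hpp : p = φ p := le_antisymm' hp.1 (hφp p hp.1 hpe).1 hp1 hp2
  obtain ⟨a1, a2, a3, a4⟩ := hg p hp.1 hpe
  have q1 : ProjEquiv p (v * p * star v) := conj_equiv h1 hp.1 hpe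
  have q2 : ProjEquiv (f - v * p * star v) (w * (f - v * p * star v) * star w) :=
    conj_equiv k1 a3 a4
  have q3 : w * (f - v * p * star v) * star w = e - p := by
    nth_rewrite 2 [hpp]
    simp [hφ]
  rw [q3] at q2
  have := equiv_add hp.1 (proj_sub hp.1 he hpe) q1 (equiv_symm q2)
    (by rw [mul_sub, hp.1.2, show p * e = p from hpe, sub_self])
    (by rw [mul_sub, a1.2, show v * p * star v * f = _ from a2, sub_self])
  simpa using this

end

end AWS

set_option linter.unusedSectionVars false
set_option linter.unusedVariables false

namespace AWS

section
variable {A : Type u} [NormedRing A] [StarRing A] [CStarRing A]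
  [NormedAlgebra ℂ A] [StarModule ℂ A] [CompleteSpace A]

lemma exists_pi (hAW : IsAWStarRing A) {e f x : A} (he : IsProjection e) (hf : IsProjection f)
    (hx : x ≠ 0) (hxe : x * e = x) (hfx : f * x = x) :
    ∃ p q : A, IsProjection p ∧ IsProjection q ∧ ProjLE p e ∧ ProjLE q f ∧ p ≠ 0 ∧
      ProjEquiv p q := by
  let _ : CStarAlgebra A := {}
  set h : A := star x * x with hh
  have hsa : IsSelfAdjoint h := IsSelfAdjoint.star_mul_self x
  have hne : h ≠ 0 := fun h0 => hx ((CStarRing.star_mul_self_eq_zero_iff _).1 h0)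
  have hnn : ∀ t ∈ spectrum ℝ h, 0 ≤ t := spectrum_star_mul_self_nonneg
  obtain ⟨t, ht, ht0⟩ : ∃ t ∈ spectrum ℝ h, t ≠ 0 := by
    by_contra! hcon
    apply hne
    rw [← cfc_id' ℝ h, ← cfc_zero ℝ h]
    exact cfc_congr (fun t ht => hcon t ht)
  have htp : 0 < t := lt_of_le_of_ne (hnn t ht) (Ne.symm ht0)
  set δ := t / 2 with hδ
  have hδp : 0 < δ := by positivity
  have hm : ∀ s : ℝ, 0 < max s δ := fun s => lt_max_of_lt_right hδp
  set g : ℝ → ℝ := fun s => (Real.sqrt (max s δ))⁻¹ with hg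
  have hgc : Continuous g := by
    apply Continuous.inv₀ (by fun_prop)
    intro s
    exact (Real.sqrt_pos.2 (hm s)).ne'
  have hg2 : ∀ s, g s * g s = (max s δ)⁻¹ := by
    intro s
    rw [hg, ← mul_inv, Real.mul_self_sqrt (hm s).le]
  set a := cfc (fun s : ℝ => max (s - δ) 0) h with ha
  set G := cfc g h with hG
  have hGs : star G = G := (cfc_predicate g h : IsSelfAdjoint G)
  have ha0 : a ≠ 0 := by
    intro h0
    rw [ha, ← cfc_zero ℝ h, cfc_eq_cfc_iff_eqOn (hf := by fun_prop) (hg := by fun_prop)] at h0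
    have := h0 ht
    simp only [Pi.zero_apply] at this
    have h3 : t - δ ≤ 0 := by rw [← this]; exact le_max_left _ _
    rw [hδ] at h3; linarith
  have hGhG : cfc (fun s => g s * s * g s) h = G * h * G := by
    rw [cfc_mul (fun s => g s * s) g h (by fun_prop) (by fun_prop),
      cfc_mul g (fun s => s) h (by fun_prop) (by fun_prop), cfc_id' ℝ h]
  have hak : a * (G * h * G - 1) = 0 := by
    rw [mul_sub, mul_one, ← hGhG, ha, ← cfc_mul _ _ h (by fun_prop) (by fun_prop), sub_eq_zero]
    apply cfc_congr
    intro s _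
    show max (s - δ) 0 * (g s * s * g s) = max (s - δ) 0
    rcases le_total s δ with hs | hs
    · rw [max_eq_right (by linarith), zero_mul]
    · have : g s * s * g s = 1 := by
        rw [mul_right_comm, hg2, max_eq_left hs, inv_mul_cancel₀ (by linarith)]
      rw [this, mul_one]
  have hah : a = cfc (fun s => max (s - δ) 0 * (g s * g s)) h * h := by
    conv_rhs => rhs; rw [← cfc_id' ℝ h]
    rw [ha, ← cfc_mul _ _ h (by fun_prop) (by fun_prop)]
    apply cfc_congr
    intro s _
    show max (s - δ) 0 = max (s - δ) 0 * (g s * g s) * s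
    rcases le_total s δ with hs | hs
    · rw [max_eq_right (by linarith), zero_mul, zero_mul]
    · rw [mul_assoc, hg2, max_eq_left hs, inv_mul_cancel₀ (by linarith), mul_one]
  obtain ⟨r, hr, hR⟩ := hAW {a}
  have hR' : ∀ b : A, a * b = 0 → (1 - r) * b = 0 := by
    intro b hb
    have : b ∈ {b : A | ∀ s ∈ ({a} : Set A), s * b = 0} := by rintro _ rfl; exact hb
    rw [hR] at this
    obtain ⟨c, rfl⟩ := this
    rw [← mul_assoc, sub_mul, one_mul, hr.2, sub_self, zero_mul]
  have har : a * r = 0 := by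
    have : r ∈ {b : A | ∀ s ∈ ({a} : Set A), s * b = 0} := by
      rw [hR]; exact ⟨1, (mul_one _).symm⟩
    exact this _ rfl
  have hq : IsProjection (1 - r) := proj_compl hr
  have hq1 : (1 - r) * (G * h * G) = 1 - r := by
    have := hR' _ hak
    rwa [mul_sub, mul_one, sub_eq_zero] at this
  have hqe : ProjLE (1 - r) e := by
    have := hR' (1 - e) (by
      rw [hah, hh, mul_assoc, mul_assoc, mul_sub x, hxe, mul_one, sub_self, mul_zero, mul_zero])
    rw [mul_sub, mul_one, sub_eq_zero] at this
    exact this.symm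
  have hq0 : 1 - r ≠ 0 := by
    intro h0
    rw [sub_eq_zero] at h0
    rw [← h0, mul_one] at har
    exact ha0 har
  have hvv : star (x * G * (1 - r)) * (x * G * (1 - r)) = 1 - r := by
    have : star (x * G * (1 - r)) * (x * G * (1 - r))
        = ((1 - r) * (G * (star x * x) * G)) * (1 - r) := by
      rw [star_mul, star_mul, hq.1, hGs]; simp only [mul_assoc]
    rw [this, ← hh, hq1, hq.2]
  have hE : ProjEquiv (1 - r) ((x * G * (1 - r)) * star (x * G * (1 - r))) := ⟨_, hvv, rfl⟩
  have hP := (equiv_elim hq hE).1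
  refine ⟨_, _, hq, hP, hqe, ?_, hq0, hE⟩
  apply le_of_left hP hf
  simp only [← mul_assoc, hfx]

lemma orth_add (hAW : IsAWStarRing A) {ι : Type*} {p q : ι → A} {e f : A}
    (hp : ∀ i, IsProjection (p i)) (hq : ∀ i, IsProjection (q i))
    (op : PairwiseOrthogonal p) (oq : PairwiseOrthogonal q)
    (h : ∀ i, ProjEquiv (p i) (q i)) (se : IsSupProj p e) (sf : IsSupProj q f)
    (hef : e * f = 0) : ProjEquiv e f := by
  have he := se.1
  have hf := sf.1
  have hfe := orth_symm he hf hef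
  have hpq : ∀ i j, p i * q j = 0 := fun i j =>
    orth_of_le2 (hp i) he (hq j) hf (se.2.1 i) (sf.2.1 j) hef
  have hqp : ∀ i j, q i * p j = 0 := fun i j => orth_symm (hp j) (hq i) (hpq j i)
  choose w w1 w2 w3 w4 w5 w6 using fun i => (equiv_elim (hp i) (h i)).2
  have pw : ∀ i, p i * w i = 0 := fun i => by rw [← w4, ← mul_assoc, hpq, zero_mul]
  have qw : ∀ i, q i * star (w i) = 0 := fun i => by rw [← w5, ← mul_assoc, hqp, zero_mul]
  have wq : ∀ i, w i * q i = 0 := fun i => by rw [← w3, mul_assoc, hpq, mul_zero]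
  have wp : ∀ i, star (w i) * p i = 0 := fun i => by rw [← w6, mul_assoc, hqp, mul_zero]
  have ww : ∀ i, w i * w i = 0 := fun i => by
    rw [← w3 i, mul_assoc, ← mul_assoc (p i), pw, zero_mul, mul_zero]
  have ww' : ∀ i, star (w i) * star (w i) = 0 := fun i => by rw [← star_mul, ww, star_zero]
  set u : ι → A := fun i => p i + q i + w i + star (w i) with hu
  have uu : ∀ i, u i * u i = (2 : ℂ) • u i := fun i => by
    simp only [hu, add_mul, mul_add, (hp i).2, (hq i).2, hpq, hqp, pw, qw, wq, wp, ww, ww', w1, w2,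
      w3, w4, w5, w6, two_smul]
    abel
  have us : ∀ i, star (u i) = u i := fun i => by
    simp only [hu, star_add, star_star, (hp i).1, (hq i).1]; abel
  set t : ι → A := fun i => (1 / 2 : ℂ) • u i with ht
  have tp : ∀ i, IsProjection (t i) := fun i => by
    refine ⟨?_, ?_⟩
    · simp only [ht, star_smul, us]; congr 1; simp
    · simp only [ht, smul_mul_smul_comm, uu, smul_smul]; congr 1; norm_num
  have uh : ∀ i, u i * (p i + q i) = u i := fun i => by
    simp only [hu, add_mul, mul_add, (hp i).2, (hq i).2, hpq, hqp, wq, wp, w3, w6]; abel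
  have hu' : ∀ i, (p i + q i) * u i = u i := fun i => by
    have := congrArg star (uh i)
    rwa [star_mul, us, star_add, (hp i).1, (hq i).1] at this
  have pu : ∀ i j, i ≠ j → p i * u j = 0 := fun i j hij => by
    rw [← hu' j, ← mul_assoc, mul_add (p i) (p j) (q j), op i j hij, hpq, add_zero, zero_mul]
  have qu : ∀ i j, i ≠ j → q i * u j = 0 := fun i j hij => by
    rw [← hu' j, ← mul_assoc, mul_add (q i) (p j) (q j), oq i j hij, hqp, add_zero, zero_mul]
  have uuo : ∀ i j, i ≠ j → u i * u j = 0 := fun i j hij => by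
    rw [← uh i, mul_assoc, add_mul (p i) (q i) (u j), pu i j hij, qu i j hij, add_zero, mul_zero]
  obtain ⟨T, hT⟩ := exists_sup hAW t tp
  have key : ∀ i (x : A), (∀ j, i ≠ j → x * u j = 0) → x * T = x * t i := by
    intro i x hx
    have h0 : (x - x * t i) * T = 0 := by
      apply sup_ann hAW tp hT
      intro j
      by_cases hij : i = j
      · subst hij
        rw [sub_mul, mul_assoc, (tp i).2, sub_self]
      · simp only [ht]
        rw [mul_smul_comm, mul_smul_comm, sub_mul, hx j hij, smul_mul_assoc, mul_assoc,
          uuo i j hij]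
        simp
    rw [sub_mul, sub_eq_zero] at h0
    rw [h0, mul_assoc, show t i * T = t i from hT.2.1 i]
  have qT : ∀ i, q i * T = (1 / 2 : ℂ) • (q i + w i) := fun i => by
    rw [key i (q i) (qu i)]
    simp only [ht, mul_smul_comm, hu, mul_add, hqp, (hq i).2, w4, qw]; simp
  have pT : ∀ i, p i * T = (1 / 2 : ℂ) • (p i + star (w i)) := fun i => by
    rw [key i (p i) (pu i)]
    simp only [ht, mul_smul_comm, hu, mul_add, hpq, (hp i).2, w5, pw]; simp
  have Tp : ∀ i, T * p i = (1 / 2 : ℂ) • (p i + w i) := fun i => by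
    have := congrArg star (pT i)
    rw [star_mul, hT.1.1, (hp i).1, star_smul, star_add, star_star, (hp i).1] at this
    rw [this]; congr 1; simp
  set W : A := (2 : ℂ) • (f * T * e) with hW
  have qW : ∀ i, q i * W = w i := fun i => by
    have e1 : q i * (f * T * e) = ((q i * f) * T) * e := by simp only [mul_assoc]
    rw [hW, mul_smul_comm, e1, show q i * f = q i from sf.2.1 i, qT, smul_mul_assoc, smul_smul,
      add_mul]
    have e2 : q i * e = 0 := orth_of_le (hq i) hf (sf.2.1 i) hfe
    have e3 : w i * e = w i := by
      rw [← w3, mul_assoc, show p i * e = p i from se.2.1 i]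
    rw [e2, e3]; norm_num
  have Wp : ∀ i, W * p i = w i := fun i => by
    have e1 : (f * T * e) * p i = f * (T * (e * p i)) := by simp only [mul_assoc]
    rw [hW, smul_mul_assoc, e1, le_symm (hp i) he (se.2.1 i), Tp, mul_smul_comm, smul_smul, mul_add]
    have e2 : f * p i = 0 := orth_symm (hp i) hf (orth_of_le (hp i) he (se.2.1 i) hef)
    have e3 : f * w i = w i := by
      rw [← w4, ← mul_assoc, le_symm (hq i) hf (sf.2.1 i)]
    rw [e2, e3]; norm_num
  have We : W * e = W := by rw [hW, smul_mul_assoc, mul_assoc, he.2]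
  have fW : star W * f = star W := by
    have : f * W = W := by
      rw [hW, mul_smul_comm, ← mul_assoc, ← mul_assoc, hf.2]
    have := congrArg star this
    rwa [star_mul, hf.1] at this
  have Wq : ∀ i, star W * q i = star (w i) := fun i => by
    have := congrArg star (qW i)
    rwa [star_mul, (hq i).1] at this
  refine ⟨W, ?_, ?_⟩
  · have := sup_ann hAW hp se (x := star W * W - e) (fun i => by
      rw [sub_mul, mul_assoc, Wp, le_symm (hp i) he (se.2.1 i), ← w4 i, ← mul_assoc, Wq, w1,
        sub_self])
    rwa [sub_mul, mul_assoc, We, he.2, sub_eq_zero] at this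
  · have := sup_ann hAW hq sf (x := W * star W - f) (fun i => by
      rw [sub_mul, mul_assoc, Wq, le_symm (hq i) hf (sf.2.1 i), ← w5 i, ← mul_assoc, Wp, w2,
        sub_self])
    rwa [sub_mul, mul_assoc, fW, hf.2, sub_eq_zero] at this

/-- two-sided annihilators are central -/
lemma central_ann (hAW : IsAWStarRing A) (S : Set A) (hS : ∀ s ∈ S, ∀ a : A, s * a ∈ S) :
    ∃ z : A, IsCentralProj z ∧ (∀ s ∈ S, s * z = 0) ∧
      ∀ b : A, (∀ s ∈ S, s * b = 0) → z * b = b := by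
  obtain ⟨z, hz, h⟩ := hAW S
  have h1 : ∀ s ∈ S, s * z = 0 := by
    have : z ∈ {a : A | ∀ s ∈ S, s * a = 0} := by rw [h]; exact ⟨1, (mul_one _).symm⟩
    exact this
  have h2 : ∀ b : A, (∀ s ∈ S, s * b = 0) → z * b = b := by
    intro b hb
    have : b ∈ {a : A | ∀ s ∈ S, s * a = 0} := hb
    rw [h] at this
    obtain ⟨c, rfl⟩ := this
    rw [← mul_assoc, hz.2]
  refine ⟨z, ⟨hz, ?_⟩, h1, h2⟩
  have h3 : ∀ a : A, z * (a * z) = a * z := fun a => h2 _ (fun s hs => by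
    rw [← mul_assoc]; exact h1 _ (hS s hs a))
  intro a
  have h4 := congrArg star (h3 (star a))
  simp only [star_mul, star_star, hz.1] at h4
  rw [← h4, mul_assoc, h3]

/-- comparability for orthogonal projections -/
lemma comparability (hAW : IsAWStarRing A) {e f : A} (he : IsProjection e) (hf : IsProjection f)
    (hef : e * f = 0) : ∃ z : A, IsCentralProj z ∧ ProjSubEquiv (z * f) (z * e) ∧
      ProjSubEquiv ((1 - z) * e) ((1 - z) * f) := by
  let Good : Set (Set (A × A)) := {S | (∀ x ∈ S, IsProjection x.1 ∧ IsProjection x.2 ∧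
    ProjLE x.1 e ∧ ProjLE x.2 f ∧ ProjEquiv x.1 x.2) ∧
    ∀ x ∈ S, ∀ y ∈ S, x ≠ y → x.1 * y.1 = 0 ∧ x.2 * y.2 = 0}
  obtain ⟨M, -, hM⟩ := zorn_subset_nonempty Good (by
    intro c hc hch hne
    refine ⟨⋃₀ c, ⟨?_, ?_⟩, fun s hs => Set.subset_sUnion_of_mem hs⟩
    · rintro x ⟨s, hs, hx⟩
      exact (hc hs).1 x hx
    · rintro x ⟨s, hs, hx⟩ y ⟨s', hs', hy⟩ hxy
      rcases hch.total hs hs' with hss | hss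
      · exact (hc hs').2 x (hss hx) y hy hxy
      · exact (hc hs).2 x hx y (hss hy) hxy) ∅ (by constructor <;> simp)
  have hMG := hM.prop
  have P1 : ∀ i : M, IsProjection i.1.1 := fun i => (hMG.1 _ i.2).1
  have P2 : ∀ i : M, IsProjection i.1.2 := fun i => (hMG.1 _ i.2).2.1
  obtain ⟨e', se⟩ := exists_sup hAW (fun i : M => i.1.1) P1
  obtain ⟨f', sf⟩ := exists_sup hAW (fun i : M => i.1.2) P2
  have e'e : ProjLE e' e := se.2.2 e he (fun i => (hMG.1 _ i.2).2.2.1)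
  have f'f : ProjLE f' f := sf.2.2 f hf (fun i => (hMG.1 _ i.2).2.2.2.1)
  have hEF : ProjEquiv e' f' := orth_add hAW P1 P2
    (fun i j hij => (hMG.2 _ i.2 _ j.2 (fun h => hij (Subtype.ext h))).1)
    (fun i j hij => (hMG.2 _ i.2 _ j.2 (fun h => hij (Subtype.ext h))).2)
    (fun i => (hMG.1 _ i.2).2.2.2.2) se sf
    (orth_of_le2 se.1 he sf.1 hf e'e f'f hef)
  have pe := proj_sub se.1 he e'e
  have pf := proj_sub sf.1 hf f'f
  have hann : ∀ a, (f - f') * a * (e - e') = 0 := by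
    intro a
    by_contra hx
    obtain ⟨p, q, hp, hq, hpe, hqf, hp0, hpq⟩ := exists_pi hAW pe pf hx
      (by rw [mul_assoc, pe.2]) (by rw [← mul_assoc, ← mul_assoc, pf.2])
    have oe : (e - e') * e' = 0 := by
      rw [sub_mul, le_symm se.1 he e'e, se.1.2, sub_self]
    have of : (f - f') * f' = 0 := by
      rw [sub_mul, le_symm sf.1 hf f'f, sf.1.2, sub_self]
    have op : ∀ x ∈ M, p * x.1 = 0 ∧ q * x.2 = 0 := fun x hx =>
      ⟨orth_of_le2 hp pe (P1 ⟨x, hx⟩) se.1 hpe (se.2.1 ⟨x, hx⟩) oe,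
       orth_of_le2 hq pf (P2 ⟨x, hx⟩) sf.1 hqf (sf.2.1 ⟨x, hx⟩) of⟩
    have hmem : insert (p, q) M ∈ Good := by
      refine ⟨?_, ?_⟩
      · rintro x (rfl | hx)
        · exact ⟨hp, hq, le_trans' hpe (sub_le' he e'e), le_trans' hqf (sub_le' hf f'f), hpq⟩
        · exact hMG.1 x hx
      · rintro x (rfl | hx) y (rfl | hy) hxy
        · exact absurd rfl hxy
        · exact op y hy
        · exact ⟨orth_symm hp (P1 ⟨x, hx⟩) (op x hx).1, orth_symm hq (P2 ⟨x, hx⟩) (op x hx).2⟩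
        · exact hMG.2 x hx y hy hxy
    have := hM.le_of_ge hmem (Set.subset_insert _ _) (Set.mem_insert _ _)
    have := (op _ this).1
    rw [hp.2] at this
    exact hp0 this
  obtain ⟨z, hz, hz1, hz2⟩ := central_ann hAW {s | ∃ a, s = (f - f') * a} (by
    rintro _ ⟨a, rfl⟩ b; exact ⟨a * b, by rw [mul_assoc]⟩)
  have k1 : (f - f') * z = 0 := hz1 _ ⟨1, by rw [mul_one]⟩
  have k2 : z * (e - e') = e - e' := hz2 _ (by rintro _ ⟨a, rfl⟩; exact hann a)
  refine ⟨z, hz, ?_, ?_⟩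
  · have : z * f = z * f' := by
      rw [← hz.2, mul_sub, sub_eq_zero] at k1; exact k1
    rw [this]
    exact ⟨z * e', central_mul hz se.1, central_mono hz e'e, central_equiv hz (equiv_symm hEF)⟩
  · have : (1 - z) * e = (1 - z) * e' := by
      rw [← sub_eq_zero, ← mul_sub, sub_mul, k2, one_mul, sub_self]
    rw [this]
    have hz' := central_compl hz
    exact ⟨(1 - z) * f', central_mul hz' sf.1, central_mono hz' f'f, central_equiv hz' hEF⟩

end

end AWS

set_option linter.unusedSectionVars false
set_option linter.unusedVariables false

namespace AWS

section
variable {A : Type u} [NormedRing A] [StarRing A] [CStarRing A]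
  [NormedAlgebra ℂ A] [StarModule ℂ A] [CompleteSpace A]

def Copies (ι : Type u) (e s : A) : Prop :=
  ∃ p : ι → A, (∀ i, IsProjection (p i)) ∧ PairwiseOrthogonal p ∧
    (∀ i, ProjEquiv (p i) e) ∧ IsSupProj p s

def Halves (f : A) : Prop :=
  ∃ a b : A, IsProjection a ∧ IsProjection b ∧ a * b = 0 ∧ ProjLE a f ∧ ProjLE b f ∧
    ProjEquiv f a ∧ ProjEquiv f b

def Tri (f : A) : Prop :=
  ∃ a b c : A, IsProjection a ∧ IsProjection b ∧ IsProjection c ∧ a * b = 0 ∧ a * c = 0 ∧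
    b * c = 0 ∧ a + b + c = f ∧ ProjEquiv a c ∧ ProjEquiv b c ∧ ProjEquiv (a + b) c

lemma tri_halves {f : A} (h : Tri f) : Halves f := by
  obtain ⟨a, b, c, ha, hb, hc, ab, ac, bc, rfl, eac, ebc, eabc⟩ := h
  have hab := proj_add ha hb ab
  have k1 : ProjEquiv (a + b) a := equiv_trans hab eabc (equiv_symm eac)
  have k2 : ProjEquiv c b := equiv_symm ebc
  have o : (a + b) * c = 0 := by rw [add_mul, ac, bc, add_zero]
  have hs := proj_add hab hc o
  have k3 : ProjEquiv (a + b + c) (a + b) := equiv_add hab hc k1 k2 o ab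
  have k4 := equiv_trans hs k3 k1
  refine ⟨a, b, ha, hb, ab, ?_, ?_, k4, ?_⟩
  · unfold ProjLE; rw [mul_add, mul_add, ab, ac, ha.2]; simp
  · unfold ProjLE; rw [mul_add, mul_add, bc, orth_symm ha hb ab, hb.2]; simp
  · exact equiv_trans hs k4 (equiv_trans ha eac (equiv_symm ebc))

lemma halves_central {z f : A} (hz : IsCentralProj z) (h : Halves f) : Halves (z * f) := by
  obtain ⟨a, b, ha, hb, ab, af, bf, ea, eb⟩ := h
  exact ⟨z * a, z * b, central_mul hz ha, central_mul hz hb, central_orth hz ab,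
    central_mono hz af, central_mono hz bf, central_equiv hz ea, central_equiv hz eb⟩

lemma sup_unique {ι : Type*} {p : ι → A} {s t : A} (hs : IsSupProj p s) (ht : IsSupProj p t) :
    s = t :=
  le_antisymm' hs.1 ht.1 (hs.2.2 t ht.1 ht.2.1) (ht.2.2 s hs.1 hs.2.1)

lemma sup_orth (hAW : IsAWStarRing A) {ι κ : Type*} {p : ι → A} {q : κ → A} {s t : A}
    (hp : ∀ i, IsProjection (p i)) (hq : ∀ i, IsProjection (q i))
    (hs : IsSupProj p s) (ht : IsSupProj q t) (h : ∀ i j, p i * q j = 0) : s * t = 0 := by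
  apply orth_symm ht.1 hs.1
  apply sup_ann hAW hp hs
  intro i
  apply orth_symm (hp i) ht.1
  exact sup_ann hAW hq ht (h i)

lemma conj_sup (hAW : IsAWStarRing A) {ι : Type*} {p : ι → A} {s v e : A}
    (h1 : star v * v = e) (hp : ∀ i, IsProjection (p i)) (hs : IsSupProj p s)
    (hse : ProjLE s e) : IsSupProj (fun i => v * p i * star v) (v * s * star v) := by
  have hpe : ∀ i, ProjLE (p i) e := fun i => le_trans' (hs.2.1 i) hse
  apply sup_of_ann (conj_proj (f := e) h1 hs.1 hse)
  · exact fun i => conj_mono h1 (hpe i) (hs.2.1 i)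
  · intro x hx
    have h0 : x * v * s = 0 := by
      apply sup_ann hAW hp hs
      intro i
      have := congrArg (· * v) (hx i)
      simp only [zero_mul] at this
      have e1 : x * (v * p i * star v) * v = x * v * (p i * (star v * v)) := by
        simp only [mul_assoc]
      rwa [e1, h1, show p i * e = p i from hpe i] at this
    rw [← mul_assoc, ← mul_assoc, h0, zero_mul]
  · exact fun i => conj_proj (f := e) h1 (hp i) (hpe i)

lemma central_sup (hAW : IsAWStarRing A) {ι : Type*} {p : ι → A} {s z : A}
    (hz : IsCentralProj z) (hp : ∀ i, IsProjection (p i)) (hs : IsSupProj p s) :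
    IsSupProj (fun i => z * p i) (z * s) := by
  apply sup_of_ann (central_mul hz hs.1)
  · exact fun i => central_mono hz (hs.2.1 i)
  · intro x hx
    rw [← mul_assoc]
    apply sup_ann hAW hp hs
    intro i
    rw [mul_assoc]; exact hx i
  · exact fun i => central_mul hz (hp i)

lemma copies_proj {ι : Type u} {e s : A} (h : Copies ι e s) : IsProjection s := by
  obtain ⟨p, h1, h2, h3, h4⟩ := h
  exact h4.1

lemma copies_reindex {ι κ : Type u} (E : ι ≃ κ) {e s : A} (h : Copies ι e s) : Copies κ e s := by
  obtain ⟨p, h1, h2, h3, h4⟩ := h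
  refine ⟨p ∘ E.symm, fun i => h1 _, fun i j hij => h2 _ _ (fun h => hij (E.symm.injective h)),
    fun i => h3 _, h4.1, fun i => h4.2.1 _, fun t ht hpt => h4.2.2 t ht fun i => ?_⟩
  have := hpt (E i)
  simpa using this

lemma copies_transport (hAW : IsAWStarRing A) {ι : Type u} {e s t : A}
    (hst : ProjEquiv s t) (h : Copies ι e s) : Copies ι e t := by
  obtain ⟨p, h1, h2, h3, h4⟩ := h
  obtain ⟨ht, v, v1, v2, v3, v4, v5, v6⟩ := equiv_elim h4.1 hst
  refine ⟨fun i => v * p i * star v, fun i => conj_proj (f := t) v1 (h1 i) (h4.2.1 i),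
    fun i j hij => conj_orth v1 (h4.2.1 i) (h2 i j hij),
    fun i => equiv_trans (conj_proj (f := t) v1 (h1 i) (h4.2.1 i))
      (equiv_symm (conj_equiv v1 (h1 i) (h4.2.1 i))) (h3 i), ?_⟩
  have := conj_sup hAW v1 h1 h4 (le_refl' h4.1)
  rwa [v3, v2] at this

lemma copies_equiv {ι : Type u} {e e' s : A} (he : ProjEquiv e e') (h : Copies ι e s) :
    Copies ι e' s := by
  obtain ⟨p, h1, h2, h3, h4⟩ := h
  exact ⟨p, h1, h2, fun i => equiv_trans (h1 i) (h3 i) he, h4⟩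

lemma copies_central (hAW : IsAWStarRing A) {ι : Type u} {e s z : A} (hz : IsCentralProj z)
    (h : Copies ι e s) : Copies ι (z * e) (z * s) := by
  obtain ⟨p, h1, h2, h3, h4⟩ := h
  exact ⟨fun i => z * p i, fun i => central_mul hz (h1 i),
    fun i j hij => central_orth hz (h2 i j hij), fun i => central_equiv hz (h3 i),
    central_sup hAW hz h1 h4⟩

lemma copies_sum (hAW : IsAWStarRing A) {ι κ : Type u} {e s : A}
    (h : Copies (ι ⊕ κ) e s) : ∃ a b, a * b = 0 ∧ a + b = s ∧ Copies ι e a ∧ Copies κ e b := by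
  obtain ⟨p, h1, h2, h3, h4⟩ := h
  obtain ⟨a, ha⟩ := exists_sup hAW (fun i => p (Sum.inl i)) (fun i => h1 _)
  obtain ⟨b, hb⟩ := exists_sup hAW (fun i => p (Sum.inr i)) (fun i => h1 _)
  have ab : a * b = 0 := sup_orth hAW (fun i => h1 _) (fun i => h1 _) ha hb
    (fun i j => h2 _ _ (by simp))
  refine ⟨a, b, ab, ?_,
    ⟨_, fun i => h1 _, fun i j hij => h2 _ _ (by simpa using hij), fun i => h3 _, ha⟩,
    ⟨_, fun i => h1 _, fun i j hij => h2 _ _ (by simpa using hij), fun i => h3 _, hb⟩⟩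
  have hab := proj_add ha.1 hb.1 ab
  refine sup_unique (p := p) (sup_of_ann hab ?_ ?_ h1) h4
  · rintro (i | i)
    · apply le_trans' (ha.2.1 i)
      unfold ProjLE; rw [mul_add, ab, ha.1.2, add_zero]
    · apply le_trans' (hb.2.1 i)
      unfold ProjLE; rw [mul_add, orth_symm ha.1 hb.1 ab, hb.1.2, zero_add]
  · intro x hx
    rw [mul_add, sup_ann hAW (fun i => h1 _) ha (fun i => hx _),
      sup_ann hAW (fun i => h1 _) hb (fun i => hx _), add_zero]

lemma copies_prod (hAW : IsAWStarRing A) {ι κ : Type u} {e s : A}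
    (h : Copies (ι × κ) e s) : ∃ q : ι → A, (∀ i, IsProjection (q i)) ∧ PairwiseOrthogonal q ∧
      (∀ i, Copies κ e (q i)) ∧ IsSupProj q s := by
  obtain ⟨p, h1, h2, h3, h4⟩ := h
  choose q hq using fun i => exists_sup hAW (fun k => p (i, k)) (fun k => h1 _)
  refine ⟨q, fun i => (hq i).1, fun i j hij => ?_, fun i => ?_, ?_⟩
  · exact sup_orth hAW (fun i => h1 _) (fun i => h1 _) (hq i) (hq j)
      (fun k l => h2 _ _ (by simp [hij]))
  · exact ⟨_, fun k => h1 _, fun k l hkl => h2 _ _ (by simpa using hkl), fun k => h3 _, hq i⟩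
  · apply sup_of_ann h4.1
    · exact fun i => (hq i).2.2 s h4.1 (fun k => h4.2.1 _)
    · intro x hx
      apply sup_ann hAW h1 h4
      rintro ⟨i, k⟩
      rw [← le_symm (h1 (i, k)) (hq i).1 ((hq i).2.1 k), ← mul_assoc, hx, zero_mul]
    · exact fun i => (hq i).1

lemma copies_orth (hAW : IsAWStarRing A) {ι : Type u} {e s t : A} (hs : Copies ι e s)
    (ht : Copies ι e t) (h : s * t = 0) : ProjEquiv s t := by
  obtain ⟨p, h1, h2, h3, h4⟩ := hs
  obtain ⟨q, k1, k2, k3, k4⟩ := ht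
  exact orth_add hAW h1 k1 h2 k2 (fun i => equiv_trans (h1 i) (h3 i) (equiv_symm (k3 i))) h4 k4 h

lemma copies_tri (hAW : IsAWStarRing A) {ι : Type u} [Infinite ι] {e s : A}
    (hs : Copies ι e s) : Tri s := by
  have hinf : Cardinal.aleph0 ≤ Cardinal.mk ι := Cardinal.aleph0_le_mk ι
  obtain ⟨E⟩ : Nonempty (ι ⊕ ι ≃ ι) := Cardinal.eq.1 (by
    rw [Cardinal.mk_sum]; simp [Cardinal.add_eq_self hinf])
  obtain ⟨d, c, dc, rfl, hd, hc⟩ := copies_sum hAW (copies_reindex E.symm hs)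
  obtain ⟨a, b, ab, rfl, ha, hb⟩ := copies_sum hAW (copies_reindex E.symm hd)
  have pa := copies_proj ha
  have pb := copies_proj hb
  have pc := copies_proj hc
  have ac : a * c = 0 := by
    have := congrArg (a * ·) dc
    simpa only [← mul_assoc, mul_add, pa.2, ab, add_zero, mul_zero] using this
  have bc : b * c = 0 := by
    have := congrArg (b * ·) dc
    simpa only [← mul_assoc, mul_add, pb.2, orth_symm pa pb ab, zero_add, mul_zero] using this
  exact ⟨a, b, c, pa, pb, pc, ab, ac, bc, rfl, copies_orth hAW ha hc ac, copies_orth hAW hb hc bc,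
    copies_orth hAW hd hc dc⟩

lemma halves_add (hAW : IsAWStarRing A) {ι : Type*} {f s t : A} {p q : ι → A} (hf : IsProjection f)
    (H : Halves f)
    (hp : ∀ i, IsProjection (p i)) (hq : ∀ i, IsProjection (q i))
    (op : PairwiseOrthogonal p) (oq : PairwiseOrthogonal q)
    (h : ∀ i, ProjEquiv (p i) (q i)) (hs : IsSupProj p s) (ht : IsSupProj q t)
    (hsf : ProjLE s f) (htf : ProjLE t f) : ProjEquiv s t := by
  obtain ⟨a, b, ha, hb, ab, af, bf, ea, eb⟩ := H
  obtain ⟨-, v, v1, v2, v3, v4, v5, v6⟩ := equiv_elim hf ea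
  obtain ⟨-, w, w1, w2, w3, w4, w5, w6⟩ := equiv_elim hf eb
  have pf : ∀ i, ProjLE (p i) f := fun i => le_trans' (hs.2.1 i) hsf
  have qf : ∀ i, ProjLE (q i) f := fun i => le_trans' (ht.2.1 i) htf
  have p1 := conj_proj (f := f) v1 hs.1 hsf
  have p2 := conj_proj (f := f) w1 ht.1 htf
  have key : ProjEquiv (v * s * star v) (w * t * star w) := by
    apply orth_add hAW (p := fun i => v * p i * star v) (q := fun i => w * q i * star w)
    · exact fun i => conj_proj (f := f) v1 (hp i) (pf i)
    · exact fun i => conj_proj (f := f) w1 (hq i) (qf i)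
    · exact fun i j hij => conj_orth v1 (pf i) (op i j hij)
    · exact fun i j hij => conj_orth w1 (qf i) (oq i j hij)
    · intro i
      exact equiv_trans (conj_proj (f := f) v1 (hp i) (pf i))
        (equiv_symm (conj_equiv v1 (hp i) (pf i)))
        (equiv_trans (hp i) (h i) (conj_equiv w1 (hq i) (qf i)))
    · exact conj_sup hAW v1 hp hs hsf
    · exact conj_sup hAW w1 hq ht htf
    · exact orth_of_le2 p1 ha p2 hb (conj_le v6) (conj_le w6) ab
  exact equiv_trans hs.1 (conj_equiv v1 hs.1 hsf)
    (equiv_trans p1 key (equiv_symm (conj_equiv w1 ht.1 htf)))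

lemma halves_copies (hAW : IsAWStarRing A) {ι : Type u} {e f s t : A} (hf : IsProjection f)
    (H : Halves f) (hs : Copies ι e s) (ht : Copies ι e t)
    (hsf : ProjLE s f) (htf : ProjLE t f) : ProjEquiv s t := by
  obtain ⟨p, h1, h2, h3, h4⟩ := hs
  obtain ⟨q, k1, k2, k3, k4⟩ := ht
  exact halves_add hAW hf H h1 k1 h2 k2
    (fun i => equiv_trans (h1 i) (h3 i) (equiv_symm (k3 i))) h4 k4 hsf htf

lemma copies_regroup (hAW : IsAWStarRing A) {ι κ : Type u} [Infinite κ] (E : ι × κ ≃ κ) {e s : A}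
    (h : Copies κ e s) : Copies ι s s := by
  obtain ⟨q, h1, h2, h3, h4⟩ := copies_prod hAW (copies_reindex E.symm h)
  exact ⟨q, h1, h2, fun i => halves_copies hAW h4.1 (tri_halves (copies_tri hAW h)) (h3 i) h
    (h4.2.1 i) (le_refl' h4.1), h4⟩

lemma absorb (hAW : IsAWStarRing A) {e g : A} (he : IsProjection e) (hg : IsProjection g)
    (H : Halves e) (o : g * e = 0) (h : ProjSubEquiv g e) : ProjEquiv (g + e) e := by
  obtain ⟨a, b, ha, hb, ab, ae, be, ea, eb⟩ := H
  obtain ⟨b', hb', hb'b, gb'⟩ := sub_trans hg he h (sub_of_equiv he eb)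
  have o' : b' * a = 0 := orth_of_le hb' hb hb'b (orth_symm ha hb ab)
  have hge := proj_add hg he o
  apply schroeder_bernstein hAW hge he
  · exact ⟨b' + a, proj_add hb' ha o', add_le' (le_trans' hb'b be) ae,
      equiv_add hg he gb' ea o o'⟩
  · apply sub_of_le he
    unfold ProjLE
    rw [mul_add, he.2, orth_symm hg he o, zero_add]

lemma seq_copies {v f f1 r : A} (hf : IsProjection f) (hf1 : IsProjection f1)
    (hr : IsProjection r) (v1 : star v * v = f)
    (v2 : v * star v = f1) (hf1f : ProjLE f1 f) (hrf : ProjLE r f) (o : r * f1 = 0) :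
    ∃ p : ℕ → A, (∀ n, IsProjection (p n)) ∧ PairwiseOrthogonal p ∧ (∀ n, ProjEquiv (p n) r) ∧
      ∀ n, ProjLE (p n) f := by
  have v6 : star v * f1 = star v := by
    rw [← v2, ← mul_assoc, v1]
    have := congrArg star (pi_right hf v1)
    rwa [star_mul, hf.1] at this
  set p : ℕ → A := fun n => (fun x => v * x * star v)^[n] r with hp
  have p0 : p 0 = r := rfl
  have ps : ∀ n, p (n + 1) = v * p n * star v := fun n => by
    simp only [hp, Function.iterate_succ_apply']
  have pf1 : ∀ n, ProjLE (p (n + 1)) f1 := fun n => by rw [ps]; exact conj_le v6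
  have pf : ∀ n, ProjLE (p n) f := by
    rintro (_ | n)
    · exact hrf
    · exact le_trans' (pf1 n) hf1f
  have pp : ∀ n, IsProjection (p n) := by
    intro n
    induction n with
    | zero => exact hr
    | succ n ih => rw [ps]; exact conj_proj (f := f) v1 ih (pf n)
  have pe : ∀ n, ProjEquiv (p n) r := by
    intro n
    induction n with
    | zero => exact equiv_refl hr
    | succ n ih =>
      have := conj_equiv v1 (pp n) (pf n)
      rw [← ps] at this
      exact equiv_trans (pp _) (equiv_symm this) ih
  have po : ∀ i k, p i * p (i + k + 1) = 0 := by
    intro i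
    induction i with
    | zero =>
      intro k
      rw [p0]
      exact orth_symm (pp _) hr (orth_of_le (pp _) hf1 (pf1 _) (orth_symm hr hf1 o))
    | succ i ih =>
      intro k
      rw [show i + 1 + k + 1 = (i + k + 1) + 1 by ring, ps, ps (i + k + 1)]
      exact conj_orth v1 (pf i) (ih k)
  refine ⟨p, pp, fun i j hij => ?_, pe, pf⟩
  rcases lt_or_gt_of_ne hij with h | h
  · obtain ⟨k, rfl⟩ := Nat.exists_eq_add_of_lt h
    exact po i k
  · obtain ⟨k, rfl⟩ := Nat.exists_eq_add_of_lt h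
    exact orth_symm (pp _) (pp _) (po j k)

lemma loc (hAW : IsAWStarRing A) {e f : A} (he : IsProjection e) (hf : IsProjection f)
    (he0 : e ≠ 0) {p : ℕ → A} (hp : ∀ n, IsProjection (p n)) (op : PairwiseOrthogonal p)
    (pe : ∀ n, ProjEquiv (p n) e) (pf : ∀ n, ProjLE (p n) f) :
    ∃ z : A, IsCentralProj z ∧ z * e ≠ 0 ∧ ∃ ι : Type u, Infinite ι ∧
      Copies ι (z * e) (z * f) := by
  let Good : Set (Set A) := {S | (∀ x ∈ S, IsProjection x ∧ ProjEquiv x e ∧ ProjLE x f) ∧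
    ∀ x ∈ S, ∀ y ∈ S, x ≠ y → x * y = 0}
  have hp0 : ∀ n, p n ≠ 0 := fun n h0 => he0 (equiv_zero' (h0 ▸ pe n))
  have pinj : Function.Injective p := by
    intro i j hij
    by_contra hne
    have := op i j hne
    rw [hij, (hp j).2] at this
    exact hp0 j this
  obtain ⟨M, hMp, hM⟩ := zorn_subset_nonempty Good (by
    intro c hc hch hne
    refine ⟨⋃₀ c, ⟨?_, ?_⟩, fun s hs => Set.subset_sUnion_of_mem hs⟩
    · rintro x ⟨s, hs, hx⟩
      exact (hc hs).1 x hx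
    · rintro x ⟨s, hs, hx⟩ y ⟨s', hs', hy⟩ hxy
      rcases hch.total hs hs' with hss | hss
      · exact (hc hs').2 x (hss hx) y hy hxy
      · exact (hc hs).2 x hx y (hss hy) hxy) (Set.range p) (by
    constructor
    · rintro _ ⟨n, rfl⟩
      exact ⟨hp n, pe n, pf n⟩
    · rintro _ ⟨n, rfl⟩ _ ⟨m, rfl⟩ hnm
      exact op n m (fun h => hnm (by rw [h])))
  have hMG := hM.prop
  have hinf : Infinite M := ((Set.infinite_range_of_injective pinj).mono hMp).to_subtype
  have P : ∀ i : M, IsProjection i.1 := fun i => (hMG.1 _ i.2).1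
  obtain ⟨s, hs⟩ := exists_sup hAW (fun i : M => i.1) P
  have hsf : ProjLE s f := hs.2.2 f hf (fun i => (hMG.1 _ i.2).2.2)
  have hC : Copies M e s := ⟨fun i => i.1, P,
    fun i j hij => hMG.2 _ i.2 _ j.2 (fun h => hij (Subtype.ext h)),
    fun i => (hMG.1 _ i.2).2.1, hs⟩
  have pg := proj_sub hs.1 hf hsf
  have gs : (f - s) * s = 0 := by rw [sub_mul, le_symm hs.1 hf hsf, hs.1.2, sub_self]
  have hmax : ¬ ProjSubEquiv e (f - s) := by
    rintro ⟨x, hx, hxg, hex⟩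
    have ox : ∀ y ∈ M, x * y = 0 := fun y hy =>
      orth_of_le2 hx pg (P ⟨y, hy⟩) hs.1 hxg (hs.2.1 ⟨y, hy⟩) gs
    have hmem : insert x M ∈ Good := by
      refine ⟨?_, ?_⟩
      · rintro y (rfl | hy)
        · exact ⟨hx, equiv_symm hex, le_trans' hxg (sub_le' hf hsf)⟩
        · exact hMG.1 y hy
      · rintro y (rfl | hy) y' (rfl | hy') hyy
        · exact absurd rfl hyy
        · exact ox y' hy'
        · exact orth_symm hx (P ⟨y, hy⟩) (ox y hy)
        · exact hMG.2 y hy y' hy' hyy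
    have := hM.le_of_ge hmem (Set.subset_insert _ _) (Set.mem_insert _ _)
    have := ox _ this
    rw [hx.2] at this
    subst this
    exact he0 (equiv_zero hex)
  have q0 : p 0 ∈ M := hMp ⟨0, rfl⟩
  have q0s : ProjLE (p 0) s := hs.2.1 ⟨_, q0⟩
  obtain ⟨z, hz, hz1, hz2⟩ := comparability hAW (hp 0) pg
    (orth_symm pg (hp 0) (orth_symm (hp 0) pg
      (orth_of_le (hp 0) hs.1 q0s (orth_symm pg hs.1 gs))))
  refine ⟨z, hz, ?_, M, hinf, ?_⟩
  · intro h0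
    have h1 : z * p 0 = 0 := by
      have := central_equiv hz (pe 0)
      rw [h0] at this
      exact equiv_zero this
    have hz' := central_compl hz
    have h2 : (1 - z) * p 0 = p 0 := by rw [sub_mul, h1, one_mul, sub_zero]
    rw [h2] at hz2
    apply hmax
    apply sub_trans he (hp 0) (sub_of_equiv he (equiv_symm (pe 0)))
    exact sub_trans (hp 0) (central_mul hz' pg) hz2
      (sub_of_le (central_mul hz' pg) (central_le hz' pg))
  · have hC' := copies_central hAW hz hC
    have hzs := copies_proj hC'
    have hzg := central_mul hz pg
    have := absorb hAW hzs hzg (tri_halves (copies_tri hAW hC')) (central_orth hz gs)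
      (sub_trans hzg (central_mul hz (hp 0)) hz1
        (sub_of_le (central_mul hz (hp 0)) (central_mono hz q0s)))
    rw [← mul_add, sub_add_cancel] at this
    exact copies_transport hAW (equiv_symm this) hC'

lemma exhaust (hAW : IsAWStarRing A) {f : A} (hf : IsProjection f) (Q : A → Prop)
    (h : ∀ y, IsCentralProj y → y * f ≠ 0 → ∃ w, IsCentralProj w ∧ w * y = w ∧ w * f ≠ 0 ∧ Q w) :
    ∃ M : Set A, (∀ z ∈ M, IsCentralProj z ∧ Q z) ∧ (∀ x ∈ M, ∀ y ∈ M, x ≠ y → x * y = 0) ∧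
      ∀ x : A, (∀ z ∈ M, x * z * f = 0) → x * f = 0 := by
  let Good : Set (Set A) := {S | (∀ x ∈ S, IsCentralProj x ∧ Q x) ∧
    ∀ x ∈ S, ∀ y ∈ S, x ≠ y → x * y = 0}
  obtain ⟨M, -, hM⟩ := zorn_subset_nonempty Good (by
    intro c hc hch hne
    refine ⟨⋃₀ c, ⟨?_, ?_⟩, fun s hs => Set.subset_sUnion_of_mem hs⟩
    · rintro x ⟨s, hs, hx⟩
      exact (hc hs).1 x hx
    · rintro x ⟨s, hs, hx⟩ y ⟨s', hs', hy⟩ hxy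
      rcases hch.total hs hs' with hss | hss
      · exact (hc hs').2 x (hss hx) y hy hxy
      · exact (hc hs).2 x hx y (hss hy) hxy) ∅ (by constructor <;> simp)
  have hMG := hM.prop
  refine ⟨M, hMG.1, hMG.2, ?_⟩
  obtain ⟨y, hy, hy1, hy2⟩ := central_ann hAW {s | ∃ z ∈ M, ∃ a, s = z * a} (by
    rintro _ ⟨z, hz, a, rfl⟩ b; exact ⟨z, hz, a * b, by rw [mul_assoc]⟩)
  have hzy : ∀ z ∈ M, z * y = 0 := fun z hz => hy1 _ ⟨z, hz, 1, by rw [mul_one]⟩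
  have hyf : y * f = 0 := by
    by_contra hne
    obtain ⟨w, hw, hwy, hwf, hQ⟩ := h y hy hne
    have ow : ∀ z ∈ M, w * z = 0 := fun z hz => by
      rw [← hwy, mul_assoc, hy.2, hzy z hz, mul_zero]
    have hmem : insert w M ∈ Good := by
      refine ⟨?_, ?_⟩
      · rintro y (rfl | hy)
        · exact ⟨hw, hQ⟩
        · exact hMG.1 y hy
      · rintro y (rfl | hy) y' (rfl | hy') hyy
        · exact absurd rfl hyy
        · exact ow y' hy'
        · rw [← hw.2]; exact ow y hy
        · exact hMG.2 y hy y' hy' hyy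
    have := hM.le_of_ge hmem (Set.subset_insert _ _) (Set.mem_insert _ _)
    have := ow _ this
    rw [hw.1.2] at this
    exact hwf (by rw [this, zero_mul])
  intro x hx
  have hs : ∀ s ∈ {s | ∃ z ∈ M, ∃ a, s = z * a}, s * star (x * f) = 0 := by
    rintro _ ⟨z, hz, a, rfl⟩
    have hzc := (hMG.1 z hz).1
    have h1 : z * star (x * f) = 0 := by
      have h2 : star (z * star (x * f)) = 0 := by
        rw [star_mul, star_star, hzc.1.1, mul_assoc, ← hzc.2 f, ← mul_assoc, hx z hz]
      rw [← star_star (z * star (x * f)), h2, star_zero]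
    rw [hzc.2 a, mul_assoc, h1, mul_zero]
  have h3 := hy2 _ hs
  have h4 : x * f * y = x * f := by
    have := congrArg star h3
    rwa [star_mul, star_star, hy.1.1] at this
  rw [← h4, mul_assoc, ← hy.2, hyf, mul_zero]

end

end AWS

set_option linter.unusedSectionVars false
set_option linter.unusedVariables false

namespace AWS

section
variable {A : Type u} [NormedRing A] [StarRing A] [CStarRing A]
  [NormedAlgebra ℂ A] [StarModule ℂ A] [CompleteSpace A]

lemma sup_add (hAW : IsAWStarRing A) {ι : Type*} {a b : ι → A} {s t : A}
    (ha : ∀ i, IsProjection (a i)) (hb : ∀ i, IsProjection (b i)) (ab : ∀ i, a i * b i = 0)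
    (hs : IsSupProj a s) (ht : IsSupProj b t) (st : s * t = 0) :
    IsSupProj (fun i => a i + b i) (s + t) := by
  have ts := orth_symm hs.1 ht.1 st
  refine sup_of_ann (proj_add hs.1 ht.1 st) (fun i => ?_) (fun x hx => ?_)
    (fun i => proj_add (ha i) (hb i) (ab i))
  · have h1 : a i * s = a i := hs.2.1 i
    have h2 : b i * t = b i := ht.2.1 i
    have h3 : a i * t = 0 := orth_of_le (ha i) hs.1 (hs.2.1 i) st
    have h4 : b i * s = 0 := orth_of_le (hb i) ht.1 (ht.2.1 i) ts
    show (a i + b i) * (s + t) = a i + b i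
    rw [add_mul, mul_add, mul_add, h1, h2, h3, h4, add_zero, zero_add]
  · have ba : ∀ i, b i * a i = 0 := fun i => orth_symm (ha i) (hb i) (ab i)
    have h1 : ∀ i, x * a i = 0 := fun i => by
      have : x * (a i + b i) * a i = x * a i := by
        rw [mul_assoc, add_mul, (ha i).2, ba i, add_zero]
      rw [← this, hx i, zero_mul]
    have h2 : ∀ i, x * b i = 0 := fun i => by
      have : x * (a i + b i) * b i = x * b i := by
        rw [mul_assoc, add_mul, (hb i).2, ab i, zero_add]
      rw [← this, hx i, zero_mul]
    rw [mul_add, sup_ann hAW ha hs h1, sup_ann hAW hb ht h2, add_zero]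

lemma tri_glue (hAW : IsAWStarRing A) {ι : Type*} {f : A} {z : ι → A} (hf : IsProjection f)
    (hz : ∀ i, IsCentralProj (z i)) (oz : ∀ i j, i ≠ j → z i * z j = 0)
    (hsup : IsSupProj (fun i => z i * f) f) (H : ∀ i, Tri (z i * f)) : Tri f := by
  choose a b c ha hb hc ab ac bc hsum eac ebc eabc using H
  have hab := fun i => proj_add (ha i) (hb i) (ab i)
  have oabc : ∀ i, (a i + b i) * c i = 0 := fun i => by rw [add_mul, ac, bc, add_zero]
  have la : ∀ i, ProjLE (a i) (z i) := fun i => by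
    refine le_trans' ?_ (central_le_left (hz i) (p := f))
    show a i * (z i * f) = a i
    rw [← hsum i, mul_add, mul_add, (ha i).2, ab, ac, add_zero, add_zero]
  have lb : ∀ i, ProjLE (b i) (z i) := fun i => by
    refine le_trans' ?_ (central_le_left (hz i) (p := f))
    show b i * (z i * f) = b i
    rw [← hsum i, mul_add, mul_add, (hb i).2, bc, orth_symm (ha i) (hb i) (ab i), add_zero,
      zero_add]
  have lc : ∀ i, ProjLE (c i) (z i) := fun i => by
    refine le_trans' ?_ (central_le_left (hz i) (p := f))
    show c i * (z i * f) = c i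
    rw [← hsum i, mul_add, mul_add, (hc i).2, orth_symm (ha i) (hc i) (ac i),
      orth_symm (hb i) (hc i) (bc i), add_zero, zero_add]
  have lab : ∀ i, ProjLE (a i + b i) (z i) := fun i => add_le' (la i) (lb i)
  have ox : ∀ {p q : ι → A}, (∀ i, IsProjection (p i)) → (∀ i, IsProjection (q i)) →
      (∀ i, ProjLE (p i) (z i)) → (∀ i, ProjLE (q i) (z i)) →
      ∀ i j, i ≠ j → p i * q j = 0 := fun hp hq lp lq i j hij =>
    orth_of_le2 (hp i) (hz i).1 (hq j) (hz j).1 (lp i) (lq j) (oz i j hij)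
  have ox' : ∀ {p q : ι → A}, (∀ i, IsProjection (p i)) → (∀ i, IsProjection (q i)) →
      (∀ i, ProjLE (p i) (z i)) → (∀ i, ProjLE (q i) (z i)) → (∀ i, p i * q i = 0) →
      ∀ i j, p i * q j = 0 := fun hp hq lp lq h i j => by
    by_cases hij : i = j
    · subst hij; exact h i
    · exact ox hp hq lp lq i j hij
  obtain ⟨sa, hsa⟩ := exists_sup hAW a ha
  obtain ⟨sb, hsb⟩ := exists_sup hAW b hb
  obtain ⟨sc, hsc⟩ := exists_sup hAW c hc
  have oab := sup_orth hAW ha hb hsa hsb (ox' ha hb la lb ab)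
  have oac := sup_orth hAW ha hc hsa hsc (ox' ha hc la lc ac)
  have obc := sup_orth hAW hb hc hsb hsc (ox' hb hc lb lc bc)
  have hsab := sup_add hAW ha hb ab hsa hsb oab
  have oabc' : (sa + sb) * sc = 0 := by rw [add_mul, oac, obc, add_zero]
  have hsabc := sup_add hAW hab hc oabc hsab hsc oabc'
  refine ⟨sa, sb, sc, hsa.1, hsb.1, hsc.1, oab, oac, obc, ?_, ?_, ?_, ?_⟩
  · refine sup_unique hsabc ?_
    have : (fun i => a i + b i + c i) = fun i => z i * f := funext hsum
    rw [this]; exact hsup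
  · exact orth_add hAW ha hc (ox ha ha la la) (ox hc hc lc lc) eac hsa hsc oac
  · exact orth_add hAW hb hc (ox hb hb lb lb) (ox hc hc lc lc) ebc hsb hsc obc
  · exact orth_add hAW hab hc (ox hab hab lab lab) (ox hc hc lc lc) eabc hsab hsc oabc'

lemma exhaust_sup {f g : A} (hf : IsProjection f) (hg : IsProjection g) (hgf : ProjLE g f)
    {M : Set A} (hM : ∀ z ∈ M, IsCentralProj z)
    (h : ∀ x : A, (∀ z ∈ M, x * z * f = 0) → x * f = 0) :
    IsSupProj (fun z : M => (z : A) * g) g := by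
  refine sup_of_ann hg (fun z => central_le (hM z z.2) hg) (fun x hx => ?_)
    (fun z => central_mul (hM z z.2) hg)
  have hgf' : g * f = g := hgf
  rw [← hgf', ← mul_assoc]
  refine h _ fun z hz => ?_
  have := hx ⟨z, hz⟩
  simp only at this
  rw [mul_assoc x g z, ← (hM z hz).2 g, this, zero_mul]

lemma tri_of_pi (hAW : IsAWStarRing A) {f : A} (hf : ProperlyInfinite f) : Tri f := by
  obtain ⟨hfp, hf0, hinf⟩ := hf
  obtain ⟨M, hM, oM, hx⟩ := exhaust hAW hfp (fun w => Tri (w * f)) (by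
    intro y hy hyf
    have hn := hinf y hy hyf
    unfold ProjFinite at hn
    push Not at hn
    obtain ⟨g, hg, hyg, hgle, hne⟩ := hn
    have hyp := central_mul hy hfp
    obtain ⟨v, v1, v2⟩ := hyg
    have hr := proj_sub hg hyp hgle
    have hrle := sub_le' hyp hgle
    have o : (y * f - g) * g = 0 := by
      rw [sub_mul, le_symm hg hyp hgle, hg.2, sub_self]
    obtain ⟨p, hp, op, pr, pf⟩ := seq_copies hyp hg hr v1 v2 hgle hrle o
    obtain ⟨z, hz, hz0, ι, hι, hC⟩ := loc hAW hr hyp (sub_ne_zero.2 (Ne.symm hne)) hp op pr pf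
    refine ⟨z * y, central_mul_central hz hy, ?_, ?_, ?_⟩
    · rw [mul_assoc, hy.1.2]
    · intro h0
      apply hz0
      rw [← le_symm hr hyp hrle, ← mul_assoc, ← mul_assoc, h0, zero_mul]
    · rw [mul_assoc]; exact copies_tri hAW hC)
  refine tri_glue hAW (z := fun i : M => (i : A)) hfp (fun i => (hM i i.2).1) ?_
    (exhaust_sup hfp hfp (le_refl' hfp) (fun z hz => (hM z hz).1) hx) (fun i => (hM i i.2).2)
  intro i j hij
  exact oM i i.2 j j.2 (fun h => hij (Subtype.ext h))

lemma gamma_bdd {e : A} (he0 : e ≠ 0) : BddAbove {c : Cardinal.{u} |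
    ∃ (ι : Type u) (p : ι → A), InGamma e p ∧ c = Order.succ (Cardinal.mk ι)} := by
  refine ⟨Order.succ (Cardinal.mk A), ?_⟩
  rintro c ⟨ι, p, ⟨hp, op, pe, ps⟩, rfl⟩
  apply Order.succ_le_succ
  refine Cardinal.mk_le_of_injective (f := p) (fun i j hij => ?_)
  by_contra hne
  have h1 := op i j hne
  rw [← hij, (hp i).2] at h1
  have h2 := pe i
  rw [h1] at h2
  exact he0 (equiv_zero' h2)

lemma lt_projDim {e : A} (he0 : e ≠ 0) {ι : Type u} (h : Copies ι e e) :
    Cardinal.mk ι < projDim e := by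
  obtain ⟨p, hp⟩ := h
  unfold projDim
  rw [if_neg he0]
  exact lt_of_lt_of_le (Order.lt_succ _) (le_csSup (gamma_bdd he0) ⟨ι, p, hp, rfl⟩)

lemma of_lt_projDim {e : A} (he0 : e ≠ 0) {a : Cardinal.{u}} (h : a < projDim e) :
    ∃ κ : Type u, Copies κ e e ∧ a ≤ Cardinal.mk κ := by
  unfold projDim at h
  rw [if_neg he0] at h
  have hne : {c : Cardinal.{u} |
    ∃ (ι : Type u) (p : ι → A), InGamma e p ∧ c = Order.succ (Cardinal.mk ι)}.Nonempty := by
    by_contra hem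
    rw [Set.not_nonempty_iff_eq_empty] at hem
    rw [hem, csSup_empty] at h
    exact not_lt_bot h
  obtain ⟨_, ⟨κ, p, hp, rfl⟩, hlt⟩ := exists_lt_of_lt_csSup hne h
  exact ⟨κ, ⟨p, hp⟩, Order.lt_succ_iff.1 hlt⟩

theorem main (hAW : IsAWStarRing A) (e f c : A)
    (he : Equidimensional e) (hf : Equidimensional f)
    (hce : IsCentralCover e c) (hcf : IsCentralCover f c)
    (hef : ProjLT e f) :
    projDim e < projDim f := by
  have hep := he.1.1
  have hfp := hf.1.1
  have he0 := he.1.2.1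
  rcases hef with ⟨⟨e', he', hle, hee⟩, hne⟩ | ⟨h, -⟩
  swap
  · exact absurd h he0
  by_contra hlt
  rw [not_lt] at hlt
  apply hne
  have He := tri_halves (tri_of_pi hAW he.1)
  have Hf := tri_halves (tri_of_pi hAW hf.1)
  have key : ∀ {x y z : A}, IsCentralProj z → IsCentralCover x c → IsCentralCover y c →
      z * x = 0 → IsProjection y → z * y = 0 := by
    intro x y z hz hx hy h hyp
    have h1 : ProjLE x (1 - z) := by
      show x * (1 - z) = x
      rw [mul_sub, mul_one, ← hz.2, h, sub_zero]
    have h2 : y * (1 - z) = y := le_trans' hy.2.1 (hx.2.2 _ (central_compl hz) h1)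
    rw [mul_sub, mul_one, ← hz.2, sub_eq_self] at h2
    exact h2
  obtain ⟨M, hM, oM, hx⟩ := exhaust hAW hfp (fun w => ProjEquiv (w * e') (w * f)) (by
    intro y hy hyf
    have hye : y * e ≠ 0 := fun h => hyf (key hy hce hcf h hfp)
    have hyep := central_mul hy hep
    have hyfp := central_mul hy hfp
    obtain ⟨a, b, ha, hb, ab, hae, hbe, ea, eb⟩ := halves_central hy He
    obtain ⟨v, v1, v2⟩ := ea
    obtain ⟨p, hp, op, pr, pf⟩ := seq_copies hyep ha hb v1 v2 hae hbe (orth_symm ha hb ab)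
    have hyee := central_equiv hy hee
    obtain ⟨hye'p, u, u1, u2, u3, u4, u5, u6⟩ := equiv_elim hyep hyee
    have hle' := central_mono hy hle
    obtain ⟨z, hz, hz0, ι, hι, hC⟩ := loc hAW (p := fun n => u * p n * star u) hyep hyfp hye
      (fun n => conj_proj (f := y * e') u1 (hp n) (pf n))
      (fun i j hij => conj_orth u1 (pf i) (op i j hij))
      (fun n => equiv_trans (conj_proj (f := y * e') u1 (hp n) (pf n))
        (equiv_symm (conj_equiv u1 (hp n) (pf n)))
        (equiv_trans (hp n) (pr n) (equiv_symm eb)))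
      (fun n => le_trans' (conj_le u6) hle')
    have hw := central_mul_central hz hy
    rw [← mul_assoc, ← mul_assoc] at hC
    rw [← mul_assoc] at hz0
    have hwf : z * y * f ≠ 0 := fun h => hz0 (key hw hcf hce h hep)
    refine ⟨z * y, hw, ?_, hwf, ?_⟩
    · rw [mul_assoc, hy.1.2]
    · have E1 : Nonempty (ι × ι ≃ ι) := by
        rw [← Cardinal.eq]
        simp
      obtain ⟨E1⟩ := E1
      have h1 := lt_projDim hwf (copies_regroup hAW E1 hC)
      rw [hf.2 _ hw hwf] at h1
      have h2 := lt_of_lt_of_le h1 hlt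
      rw [← he.2 _ hw hz0] at h2
      obtain ⟨κ, hκ, hικ⟩ := of_lt_projDim hz0 h2
      have hκi : Infinite κ := by
        rw [Cardinal.infinite_iff] at hι ⊢
        exact hι.trans hικ
      have E2 : Nonempty (ι × κ ≃ κ) := by
        rw [← Cardinal.eq]
        simp only [Cardinal.mk_prod, Cardinal.lift_id]
        rw [Cardinal.mul_eq_right (Cardinal.infinite_iff.1 hκi) hικ (Cardinal.mk_ne_zero ι)]
      obtain ⟨E2⟩ := E2
      have h3 := copies_transport hAW (central_equiv hw hee) (copies_regroup hAW E2 hκ)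
      exact halves_copies hAW (central_mul hw hfp) (halves_central hw Hf) h3 hC
        (central_mono hw hle) (le_refl' (central_mul hw hfp)))
  refine equiv_trans hep hee ?_
  have oo : ∀ {g : A}, IsProjection g → PairwiseOrthogonal (fun z : M => (z : A) * g) := by
    intro g hg i j hij
    have hi := (hM i i.2).1
    have hj := (hM j j.2).1
    exact orth_of_le2 (central_mul hi hg) hi.1 (central_mul hj hg) hj.1 (central_le_left hi)
      (central_le_left hj) (oM i i.2 j j.2 (fun h => hij (Subtype.ext h)))
  exact halves_add hAW hfp Hf (fun i : M => central_mul (hM i i.2).1 he')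
    (fun i : M => central_mul (hM i i.2).1 hfp) (oo he') (oo hfp) (fun i => (hM i i.2).2)
    (exhaust_sup hfp he' hle (fun z hz => (hM z hz).1) hx)
    (exhaust_sup hfp hfp (le_refl' hfp) (fun z hz => (hM z hz).1) hx) hle (le_refl' hfp)

end

end AWS

/-- If `e` and `f` are properly infinite equidimensional projections with the
same central cover and `e ≺ f`, then `d(e) < d(f)`. -/
theorem projDim_lt_of_lt {A : Type u} [NormedRing A] [StarRing A] [CStarRing A]
    [NormedAlgebra ℂ A] [StarModule ℂ A] [CompleteSpace A]
    (hAW : IsAWStarRing A) (e f c : A)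
    (he : Equidimensional e) (hf : Equidimensional f)
    (hce : IsCentralCover e c) (hcf : IsCentralCover f c)
    (hef : ProjLT e f) :
    projDim e < projDim f := by
  exact AWS.main hAW e f c he hf hce hcf hef
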